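/- Let H be a Hopf algebra with bijective antipode and let F : ᴴᴴYD → ᴴᵒᵖ_{Hᵒᵖ}YD be the functor sending (M, ·, δ) to (M, ·_op, δ) where h ·_op m = S⁻¹(h)·m, and sending a morphism to itself. For M, N ∈ ᴴᴴYD, the map ϑ_{M,N} : F(M ⊗ N) → F(M) ⊗ F(N) defined by ϑ_{M,N}(m ⊗ n) = S⁻¹(n₍₋₁₎)·m ⊗ n₍₀₎ is a bijection with inverse m ⊗ n ↦ n₍₋₁₎·m ⊗ n₍₀₎, and it is a morphism of left H^op-modules. -/

import Mathlib

open TensorProduct Coalgebra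

universe u

variable {k H M : Type u} [Field k] [Ring H] [HopfAlgebra k H]
  [AddCommGroup M] [Module k M]

/-- The left hand side `h ⊗ m ↦ h₁ m₍₋₁₎ ⊗ h₂ · m₍₀₎` of the Yetter–Drinfel'd
compatibility condition, as a linear map `H ⊗ M → H ⊗ M`. -/
noncomputable def ydLHS (act : H ⊗[k] M →ₗ[k] M) (coact : M →ₗ[k] H ⊗[k] M) :
    H ⊗[k] M →ₗ[k] H ⊗[k] M :=
  TensorProduct.map (LinearMap.mul' k H) act
    ∘ₗ (TensorProduct.tensorTensorTensorComm k H H H M).toLinearMap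
    ∘ₗ TensorProduct.map (Coalgebra.comul : H →ₗ[k] H ⊗[k] H) coact

/-- The right hand side `h ⊗ m ↦ (h₁ · m)₍₋₁₎ h₂ ⊗ (h₁ · m)₍₀₎` of the Yetter–Drinfel'd
compatibility condition, as a linear map `H ⊗ M → H ⊗ M`. -/
noncomputable def ydRHS (act : H ⊗[k] M →ₗ[k] M) (coact : M →ₗ[k] H ⊗[k] M) :
    H ⊗[k] M →ₗ[k] H ⊗[k] M :=
  TensorProduct.map (LinearMap.mul' k H ∘ₗ (TensorProduct.comm k H H).toLinearMap) LinearMap.id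
    ∘ₗ (TensorProduct.assoc k H H M).symm.toLinearMap
    ∘ₗ TensorProduct.map LinearMap.id (coact ∘ₗ act)
    ∘ₗ (TensorProduct.assoc k H H M).toLinearMap
    ∘ₗ TensorProduct.map (TensorProduct.comm k H H).toLinearMap LinearMap.id
    ∘ₗ TensorProduct.map (Coalgebra.comul : H →ₗ[k] H ⊗[k] H) LinearMap.id

/-- the diagonal action `h ⊗ (m ⊗ n) ↦ h₁·m ⊗ h₂·n` on a tensor product of `H`-modules. -/
noncomputable def actTensor {N : Type u} [AddCommGroup N] [Module k N]
    (actM : H ⊗[k] M →ₗ[k] M) (actN : H ⊗[k] N →ₗ[k] N) :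
    H ⊗[k] (M ⊗[k] N) →ₗ[k] M ⊗[k] N :=
  TensorProduct.map actM actN
    ∘ₗ (TensorProduct.tensorTensorTensorComm k H H M N).toLinearMap
    ∘ₗ TensorProduct.map (Coalgebra.comul : H →ₗ[k] H ⊗[k] H) LinearMap.id

/-- `ϑ_{M,N} : m ⊗ n ↦ S⁻¹(n₍₋₁₎)·m ⊗ n₍₀₎`. -/
noncomputable def thetaMap {N : Type u} [AddCommGroup N] [Module k N]
    (Sinv : H →ₗ[k] H) (actM : H ⊗[k] M →ₗ[k] M) (coactN : N →ₗ[k] H ⊗[k] N) :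
    M ⊗[k] N →ₗ[k] M ⊗[k] N :=
  TensorProduct.map (actM ∘ₗ TensorProduct.map Sinv LinearMap.id) LinearMap.id
    ∘ₗ TensorProduct.map (TensorProduct.comm k M H).toLinearMap LinearMap.id
    ∘ₗ (TensorProduct.assoc k M H N).symm.toLinearMap
    ∘ₗ TensorProduct.map LinearMap.id coactN

/-- `m ⊗ n ↦ n₍₋₁₎·m ⊗ n₍₀₎`. -/
noncomputable def thetaInvMap {N : Type u} [AddCommGroup N] [Module k N]
    (actM : H ⊗[k] M →ₗ[k] M) (coactN : N →ₗ[k] H ⊗[k] N) :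
    M ⊗[k] N →ₗ[k] M ⊗[k] N :=
  TensorProduct.map actM LinearMap.id
    ∘ₗ TensorProduct.map (TensorProduct.comm k M H).toLinearMap LinearMap.id
    ∘ₗ (TensorProduct.assoc k M H N).symm.toLinearMap
    ∘ₗ TensorProduct.map LinearMap.id coactN


section Helpers

open HopfAlgebra WithConv

/-- Coassociativity in Sweedler sums. -/
theorem coassoc_sum8 {k H X : Type u} [Field k] [Ring H] [HopfAlgebra k H]
    [AddCommGroup X] [Module k X] (f : H →ₗ[k] H →ₗ[k] H →ₗ[k] X) (g : H) :
    ∑ i ∈ (ℛ k g).index, ∑ j ∈ (ℛ k ((ℛ k g).right i)).index,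
      f ((ℛ k g).left i) ((ℛ k ((ℛ k g).right i)).left j) ((ℛ k ((ℛ k g).right i)).right j)
    = ∑ i ∈ (ℛ k g).index, ∑ j ∈ (ℛ k ((ℛ k g).left i)).index,
      f ((ℛ k ((ℛ k g).left i)).left j) ((ℛ k ((ℛ k g).left i)).right j) ((ℛ k g).right i) := by
  let F : H ⊗[k] (H ⊗[k] H) →ₗ[k] X :=
    TensorProduct.lift (TensorProduct.lift f) ∘ₗ (TensorProduct.assoc k H H H).symm.toLinearMap
  have h := congrArg F (Coalgebra.coassoc_apply (R := k) g)
  rw [← (ℛ k g).eq] at h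
  simp only [map_sum, LinearMap.rTensor_tmul, LinearMap.lTensor_tmul] at h
  refine Eq.trans ?_ (h.symm.trans ?_)
  · refine Finset.sum_congr rfl fun i _ => ?_
    conv_rhs => rw [← (ℛ k ((ℛ k g).right i)).eq]
    simp [TensorProduct.tmul_sum, F]
  · refine Finset.sum_congr rfl fun i _ => ?_
    conv_lhs => rw [← (ℛ k ((ℛ k g).left i)).eq]
    simp [TensorProduct.sum_tmul, F]

/-- Convolution action on the left cancels. -/
theorem conv_left8 {k H X : Type u} [Field k] [Ring H] [HopfAlgebra k H]
    [AddCommGroup X] [Module k X] (l : H →ₗ[k] X →ₗ[k] X)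
    (l1 : ∀ x, l 1 x = x) (l2 : ∀ a b x, l (a * b) x = l a (l b x))
    (P Q : H →ₗ[k] X)
    (h : ∀ g, P g = ∑ i ∈ (ℛ k g).index, l ((ℛ k g).left i) (Q ((ℛ k g).right i))) (g : H) :
    Q g = ∑ i ∈ (ℛ k g).index, l (antipode k ((ℛ k g).left i)) (P ((ℛ k g).right i)) := by
  have key := coassoc_sum8 (k := k)
    (LinearMap.mk₂ k (fun a b => l (antipode k a * b) ∘ₗ Q)
      (by intros; ext; simp [add_mul]) (by intros; ext; simp)
      (by intros; ext; simp [mul_add]) (by intros; ext; simp)) g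
  simp only [LinearMap.mk₂_apply, LinearMap.comp_apply] at key
  simp only [h, map_sum, ← l2]
  rw [key]
  simp only [← LinearMap.sum_apply, ← map_sum, sum_antipode_mul_eq_smul]
  simp only [map_smul, LinearMap.smul_apply, l1]
  simp only [← map_smul, ← map_sum, sum_counit_smul]

/-- Convolution action on the right cancels. -/
theorem conv_right8 {k H X : Type u} [Field k] [Ring H] [HopfAlgebra k H]
    [AddCommGroup X] [Module k X] (r : H →ₗ[k] X →ₗ[k] X)
    (r1 : ∀ x, r 1 x = x) (r2 : ∀ a b x, r (a * b) x = r b (r a x))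
    (P Q : H →ₗ[k] X)
    (h : ∀ g, P g = ∑ i ∈ (ℛ k g).index, r ((ℛ k g).right i) (Q ((ℛ k g).left i))) (g : H) :
    Q g = ∑ i ∈ (ℛ k g).index, r (antipode k ((ℛ k g).right i)) (P ((ℛ k g).left i)) := by
  have key := coassoc_sum8 (k := k)
    (LinearMap.mk₂ k (fun a b => (r.flip (Q a)) ∘ₗ LinearMap.mulLeft k b ∘ₗ antipode k)
      (by intros; ext; simp) (by intros; ext; simp)
      (by intros; ext; simp [add_mul]) (by intros; ext; simp)) g
  simp only [LinearMap.mk₂_apply, LinearMap.comp_apply, LinearMap.flip_apply,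
    LinearMap.mulLeft_apply] at key
  simp only [h, map_sum, ← r2]
  rw [← key]
  simp only [← LinearMap.sum_apply, ← map_sum, sum_mul_antipode_eq_smul]
  simp only [map_smul, LinearMap.smul_apply, r1]
  simp only [← map_smul, ← map_sum]
  congr 1
  have := congrArg (TensorProduct.rid k H) (Coalgebra.sum_tmul_counit_eq (ℛ k g))
  simp only [map_sum, TensorProduct.rid_tmul, one_smul] at this
  exact this.symm

theorem comul_antipode8 {k H : Type u} [Field k] [Ring H] [HopfAlgebra k H] (g : H) :
    comul (R := k) (antipode k g)
      = ∑ i ∈ (ℛ k g).index,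
          antipode k ((ℛ k g).right i) ⊗ₜ[k] antipode k ((ℛ k g).left i) := by
  let iL : H →ₐ[k] H ⊗[k] H := Algebra.TensorProduct.includeLeft
  let iR : H →ₐ[k] H ⊗[k] H := Algebra.TensorProduct.includeRight
  have hd : toConv (comul (R := k) (A := H)) = toConv iL.toLinearMap * toConv iR.toLinearMap := by
    ext g
    rw [(ℛ k g).convMul_apply]
    simp [iL, iR, (ℛ k g).eq]
  have hc : ∀ i : H →ₐ[k] H ⊗[k] H,
      toConv (i.toLinearMap ∘ₗ antipode k) * toConv i.toLinearMap = 1 := by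
    intro i
    ext g
    rw [(ℛ k g).convMul_apply]
    simp [← map_mul, ← map_sum, sum_antipode_mul_eq_algebraMap_counit]
  have hG : (toConv (iR.toLinearMap ∘ₗ antipode k) * toConv (iL.toLinearMap ∘ₗ antipode k))
      * toConv (comul (R := k) (A := H)) = 1 := by
    rw [hd, mul_assoc, ← mul_assoc (toConv (iL.toLinearMap ∘ₗ antipode k)), hc, one_mul, hc]
  have := left_inv_eq_right_inv hG LinearMap.comul_right_inv
  have := congrArg (fun f => f.ofConv g) this
  change _ = comul (R := k) (antipode k g) at this
  rw [← this]
  change (toConv (iR.toLinearMap ∘ₗ antipode k) * toConv (iL.toLinearMap ∘ₗ antipode k)) g = _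
  rw [(ℛ k g).convMul_apply]
  simp [iL, iR]

variable {N : Type u} [AddCommGroup N] [Module k N]

/-- `x ⊗ n ↦ p(x)·m ⊗ n` -/
noncomputable def psi8 (p : H →ₗ[k] H) (actM : H ⊗[k] M →ₗ[k] M) (m : M) :
    H ⊗[k] N →ₗ[k] M ⊗[k] N :=
  TensorProduct.map (actM ∘ₗ (TensorProduct.mk k H M).flip m ∘ₗ p) LinearMap.id

theorem theta_tmul8 (p : H →ₗ[k] H) (actM : H ⊗[k] M →ₗ[k] M) (coactN : N →ₗ[k] H ⊗[k] N)
    (m : M) (n : N) : thetaMap p actM coactN (m ⊗ₜ n) = psi8 p actM m (coactN n) := by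
  simp only [thetaMap, psi8, LinearMap.comp_apply, TensorProduct.map_tmul, LinearMap.id_apply]
  induction coactN n with
  | zero => simp
  | add x y hx hy => simp only [TensorProduct.tmul_add, map_add, hx, hy]
  | tmul x y => simp

theorem thetaInv_eq8 (actM : H ⊗[k] M →ₗ[k] M) (coactN : N →ₗ[k] H ⊗[k] N) :
    thetaInvMap actM coactN = thetaMap LinearMap.id actM coactN := by
  simp [thetaMap, thetaInvMap]

theorem theta_comp8 (p q : H →ₗ[k] H) (actM : H ⊗[k] M →ₗ[k] M) (coactN : N →ₗ[k] H ⊗[k] N)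
    (hactM1 : ∀ m : M, actM ((1 : H) ⊗ₜ m) = m)
    (hactM2 : ∀ (g h : H) (m : M), actM ((g * h) ⊗ₜ m) = actM (g ⊗ₜ actM (h ⊗ₜ m)))
    (hcoN1 : TensorProduct.map (Coalgebra.comul : H →ₗ[k] H ⊗[k] H) LinearMap.id ∘ₗ coactN
      = (TensorProduct.assoc k H H N).symm.toLinearMap
          ∘ₗ TensorProduct.map LinearMap.id coactN ∘ₗ coactN)
    (hcoN2 : (TensorProduct.lid k N).toLinearMap
        ∘ₗ TensorProduct.map (Coalgebra.counit : H →ₗ[k] k) LinearMap.id ∘ₗ coactN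
      = LinearMap.id)
    (hpq : ∀ g : H, ∑ i ∈ (ℛ k g).index, q ((ℛ k g).right i) * p ((ℛ k g).left i)
      = counit (R := k) g • (1 : H)) :
    thetaMap q actM coactN ∘ₗ thetaMap p actM coactN = LinearMap.id := by
  ext m n
  simp only [TensorProduct.AlgebraTensorModule.curry_apply, TensorProduct.curry_apply,
    LinearMap.restrictScalars_self, LinearMap.comp_apply, LinearMap.id_apply]
  rw [theta_tmul8]
  -- `(x ⊗ y) ⊗ n ↦ (q y * p x) m ⊗ n`
  let K : (H ⊗[k] H) ⊗[k] N →ₗ[k] M ⊗[k] N :=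
    TensorProduct.map (actM ∘ₗ (TensorProduct.mk k H M).flip m ∘ₗ LinearMap.mul' k H ∘ₗ
      TensorProduct.map q p ∘ₗ (TensorProduct.comm k H H).toLinearMap) LinearMap.id
  have e1 : ∀ z : H ⊗[k] N, thetaMap q actM coactN (psi8 p actM m z)
      = K ((TensorProduct.assoc k H H N).symm (TensorProduct.map LinearMap.id coactN z)) := by
    intro z
    induction z with
    | zero => simp
    | add x y hx hy => simp only [map_add, hx, hy]
    | tmul x y =>
      simp only [psi8, TensorProduct.map_tmul, theta_tmul8, LinearMap.id_apply]
      induction coactN y with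
      | zero => simp
      | add x y hx hy => simp only [TensorProduct.tmul_add, map_add, hx, hy]
      | tmul a b => simp [K, hactM2]
  have e2 : ∀ z : H ⊗[k] N, K (TensorProduct.map comul LinearMap.id z)
      = m ⊗ₜ TensorProduct.lid k N (TensorProduct.map counit LinearMap.id z) := by
    intro z
    induction z with
    | zero => simp
    | add x y hx hy => simp only [map_add, hx, hy, TensorProduct.tmul_add]
    | tmul x y =>
      have h3 : LinearMap.mul' k H (TensorProduct.map q p (TensorProduct.comm k H H (comul x)))
          = counit (R := k) x • (1 : H) := by
        rw [← hpq, ← (ℛ k x).eq]; simp [map_sum]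
      simp only [K, TensorProduct.map_tmul, LinearMap.comp_apply, LinearEquiv.coe_coe, h3]
      simp [hactM1, TensorProduct.smul_tmul]
  rw [e1]
  have h1 := LinearMap.congr_fun hcoN1 n
  have h2 := LinearMap.congr_fun hcoN2 n
  simp only [LinearMap.comp_apply, LinearEquiv.coe_coe, LinearMap.id_apply] at h1 h2
  rw [← h1, e2, h2]

/-- The key consequence of the Yetter–Drinfel'd condition:
`S(g₁)(g₂n)₍₋₁₎ ⊗ (g₂n)₍₀₎ = n₍₋₁₎S(g₂) ⊗ g₁n₍₀₎`. -/
theorem yd_key8 (actN : H ⊗[k] N →ₗ[k] N) (coactN : N →ₗ[k] H ⊗[k] N)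
    (hydN : ydLHS actN coactN = ydRHS actN coactN) (g : H) (n : N) :
    ∑ i ∈ (ℛ k g).index, (LinearMap.mulLeft k (antipode k ((ℛ k g).left i))).rTensor N
        (coactN (actN ((ℛ k g).right i ⊗ₜ n)))
    = ∑ i ∈ (ℛ k g).index, TensorProduct.map
        (LinearMap.mulRight k (antipode k ((ℛ k g).right i)))
        (actN ∘ₗ TensorProduct.mk k H N ((ℛ k g).left i)) (coactN n) := by
  let l : H →ₗ[k] (H ⊗[k] N) →ₗ[k] (H ⊗[k] N) :=
    LinearMap.rTensorHom N ∘ₗ LinearMap.mul k H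
  let r : H →ₗ[k] (H ⊗[k] N) →ₗ[k] (H ⊗[k] N) :=
    LinearMap.rTensorHom N ∘ₗ (LinearMap.mul k H).flip
  have l1 : ∀ x, l 1 x = x := by
    intro x
    induction x with
    | zero => simp
    | add x y hx hy => simp only [map_add, hx, hy]
    | tmul x y => simp [l]
  have r1 : ∀ x, r 1 x = x := by
    intro x
    induction x with
    | zero => simp
    | add x y hx hy => simp only [map_add, hx, hy]
    | tmul x y => simp [r]
  have l2 : ∀ a b x, l (a * b) x = l a (l b x) := by
    intro a b x
    induction x with
    | zero => simp
    | add x y hx hy => simp only [map_add, hx, hy]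
    | tmul x y => simp [l, mul_assoc]
  have r2 : ∀ a b x, r (a * b) x = r b (r a x) := by
    intro a b x
    induction x with
    | zero => simp
    | add x y hx hy => simp only [map_add, hx, hy]
    | tmul x y => simp [r, mul_assoc]
  have lr : ∀ a b x, l a (r b x) = r b (l a x) := by
    intro a b x
    induction x with
    | zero => simp
    | add x y hx hy => simp only [map_add, hx, hy]
    | tmul x y => simp [l, r, mul_assoc]
  let B : H →ₗ[k] H ⊗[k] N := coactN ∘ₗ actN ∘ₗ (TensorProduct.mk k H N).flip n
  let A : H →ₗ[k] H ⊗[k] N :=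
    (LinearMap.lTensorHom H ∘ₗ TensorProduct.curry actN).flip (coactN n)
  let P : H →ₗ[k] H ⊗[k] N := ydLHS actN coactN ∘ₗ (TensorProduct.mk k H N).flip n
  have hP1 : ∀ g, P g = ∑ i ∈ (ℛ k g).index, l ((ℛ k g).left i) (A ((ℛ k g).right i)) := by
    intro g
    simp only [P, ydLHS, LinearMap.comp_apply, LinearMap.flip_apply, TensorProduct.mk_apply,
      TensorProduct.map_tmul]
    conv_lhs => rw [← (ℛ k g).eq]
    simp only [TensorProduct.sum_tmul, map_sum]
    refine Finset.sum_congr rfl fun i _ => ?_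
    simp only [A, LinearMap.flip_apply]
    induction coactN n with
    | zero => simp
    | add x y hx hy => simp only [TensorProduct.tmul_add, map_add, hx, hy]
    | tmul x y => simp [l]
  have hP2 : ∀ g, P g = ∑ i ∈ (ℛ k g).index, r ((ℛ k g).right i) (B ((ℛ k g).left i)) := by
    intro g
    simp only [P, hydN, ydRHS, LinearMap.comp_apply, LinearMap.flip_apply, TensorProduct.mk_apply,
      TensorProduct.map_tmul]
    conv_lhs => rw [← (ℛ k g).eq]
    simp only [TensorProduct.sum_tmul, map_sum]
    refine Finset.sum_congr rfl fun i _ => ?_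
    simp only [B, LinearMap.comp_apply, LinearMap.flip_apply, TensorProduct.mk_apply,
      LinearEquiv.coe_coe, TensorProduct.comm_tmul, LinearMap.id_apply, TensorProduct.assoc_tmul,
      TensorProduct.map_tmul]
    induction coactN (actN ((ℛ k g).left i ⊗ₜ[k] n)) with
    | zero => simp
    | add x y hx hy => simp only [TensorProduct.tmul_add, map_add, hx, hy]
    | tmul x y => simp [r]
  -- `Q g = S(g₁) B(g₂)`
  let Q : H →ₗ[k] H ⊗[k] N :=
    TensorProduct.lift (l.compl₁₂ (antipode k) B) ∘ₗ comul
  have hQ : ∀ g, Q g = ∑ i ∈ (ℛ k g).index,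
      l (antipode k ((ℛ k g).left i)) (B ((ℛ k g).right i)) := by
    intro g
    simp only [Q, LinearMap.comp_apply]
    conv_lhs => rw [← (ℛ k g).eq]
    simp [map_sum]
  have hA : ∀ g, A g = ∑ i ∈ (ℛ k g).index, r ((ℛ k g).right i) (Q ((ℛ k g).left i)) := by
    intro g
    rw [conv_left8 l l1 l2 P A hP1 g]
    simp only [hP2, hQ, map_sum, lr]
    exact coassoc_sum8 (k := k)
      (LinearMap.mk₂ k (fun a b => r.flip (l (antipode k a) (B b)))
        (by intros; ext; simp) (by intros; ext; simp)
        (by intros; ext; simp) (by intros; ext; simp)) g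
  have fin := conv_right8 r r1 r2 A Q hA g
  rw [hQ] at fin
  refine Eq.trans ?_ (fin.trans ?_)
  · rfl
  · refine Finset.sum_congr rfl fun i _ => ?_
    simp only [A, LinearMap.flip_apply]
    induction coactN n with
    | zero => simp
    | add x y hx hy => simp only [map_add, hx, hy]
    | tmul x y => simp [r]

end Helpers

/- STATEMENT 8: For a Hopf algebra `H` with bijective antipode and Yetter–Drinfel'd modules
`M, N` over `H`, the map `ϑ_{M,N} : F(M ⊗ N) → F(M) ⊗ F(N)`,
`ϑ(m ⊗ n) = S⁻¹(n₍₋₁₎)·m ⊗ n₍₀₎`, is a bijection with inverse `m ⊗ n ↦ n₍₋₁₎·m ⊗ n₍₀₎`, and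
is a morphism of left `H^op`-modules (where the `H^op`-action on `F(M ⊗ N)` is
`h ·_op (m ⊗ n) = S⁻¹(h)·(m ⊗ n)` and on `F(M) ⊗ F(N)` it is the diagonal `·_op`-action via
the comultiplication of `H^op`, which equals that of `H`). -/
theorem stmt_8 {k H M N : Type u} [Field k] [Ring H] [HopfAlgebra k H]
    [AddCommGroup M] [Module k M] [AddCommGroup N] [Module k N]
    (Sinv : H →ₗ[k] H)
    (hS₁ : HopfAlgebra.antipode (R := k) ∘ₗ Sinv = LinearMap.id)
    (hS₂ : Sinv ∘ₗ HopfAlgebra.antipode (R := k) = LinearMap.id)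
    (actM : H ⊗[k] M →ₗ[k] M) (coactM : M →ₗ[k] H ⊗[k] M)
    (actN : H ⊗[k] N →ₗ[k] N) (coactN : N →ₗ[k] H ⊗[k] N)
    (hactM1 : ∀ m : M, actM ((1 : H) ⊗ₜ m) = m)
    (hactM2 : ∀ (g h : H) (m : M), actM ((g * h) ⊗ₜ m) = actM (g ⊗ₜ actM (h ⊗ₜ m)))
    (hactN1 : ∀ n : N, actN ((1 : H) ⊗ₜ n) = n)
    (hactN2 : ∀ (g h : H) (n : N), actN ((g * h) ⊗ₜ n) = actN (g ⊗ₜ actN (h ⊗ₜ n)))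
    (hcoM1 : TensorProduct.map (Coalgebra.comul : H →ₗ[k] H ⊗[k] H) LinearMap.id ∘ₗ coactM
      = (TensorProduct.assoc k H H M).symm.toLinearMap
          ∘ₗ TensorProduct.map LinearMap.id coactM ∘ₗ coactM)
    (hcoM2 : (TensorProduct.lid k M).toLinearMap
        ∘ₗ TensorProduct.map (Coalgebra.counit : H →ₗ[k] k) LinearMap.id ∘ₗ coactM
      = LinearMap.id)
    (hcoN1 : TensorProduct.map (Coalgebra.comul : H →ₗ[k] H ⊗[k] H) LinearMap.id ∘ₗ coactN
      = (TensorProduct.assoc k H H N).symm.toLinearMap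
          ∘ₗ TensorProduct.map LinearMap.id coactN ∘ₗ coactN)
    (hcoN2 : (TensorProduct.lid k N).toLinearMap
        ∘ₗ TensorProduct.map (Coalgebra.counit : H →ₗ[k] k) LinearMap.id ∘ₗ coactN
      = LinearMap.id)
    (hydM : ydLHS actM coactM = ydRHS actM coactM)
    (hydN : ydLHS actN coactN = ydRHS actN coactN) :
    -- `ϑ` is a bijection with the stated inverse …
    (thetaInvMap actM coactN ∘ₗ thetaMap Sinv actM coactN = LinearMap.id) ∧
    (thetaMap Sinv actM coactN ∘ₗ thetaInvMap actM coactN = LinearMap.id) ∧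
    -- … and `ϑ` is a morphism of left `H^op`-modules:
    (thetaMap Sinv actM coactN
        ∘ₗ (actTensor actM actN ∘ₗ TensorProduct.map Sinv LinearMap.id)
      = actTensor (actM ∘ₗ TensorProduct.map Sinv LinearMap.id)
          (actN ∘ₗ TensorProduct.map Sinv LinearMap.id)
        ∘ₗ TensorProduct.map LinearMap.id (thetaMap Sinv actM coactN)) := by
  have s1 : ∀ x : H, HopfAlgebra.antipode k (Sinv x) = x := fun x => LinearMap.congr_fun hS₁ x
  have s2 : ∀ x : H, Sinv (HopfAlgebra.antipode k x) = x := fun x => LinearMap.congr_fun hS₂ x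
  have smul' : ∀ x y : H, Sinv (x * y) = Sinv y * Sinv x := by
    intro x y
    rw [← s2 (Sinv y * Sinv x), HopfAlgebra.antipode_mul_antidistrib, s1, s1]
  have sone : Sinv 1 = 1 := by rw [← HopfAlgebra.antipode_one (R := k) (A := H), s2,
    HopfAlgebra.antipode_one]
  refine ⟨?_, ?_, ?_⟩
  · rw [thetaInv_eq8]
    refine theta_comp8 Sinv LinearMap.id actM coactN hactM1 hactM2 hcoN1 hcoN2 fun g => ?_
    have := congrArg Sinv (HopfAlgebra.sum_mul_antipode_eq_smul (R := k) (ℛ k g))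
    simpa [smul', s2, sone] using this
  · rw [thetaInv_eq8]
    refine theta_comp8 LinearMap.id Sinv actM coactN hactM1 hactM2 hcoN1 hcoN2 fun g => ?_
    have := congrArg Sinv (HopfAlgebra.sum_antipode_mul_eq_smul (R := k) (ℛ k g))
    simpa [smul', s2, sone] using this
  · ext h m n
    obtain ⟨g, rfl⟩ : ∃ g, HopfAlgebra.antipode k g = h := ⟨Sinv h, s1 h⟩
    simp only [TensorProduct.AlgebraTensorModule.curry_apply, TensorProduct.curry_apply,
      LinearMap.restrictScalars_self, LinearMap.comp_apply, LinearMap.id_apply,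
      TensorProduct.map_tmul, s2, actTensor, theta_tmul8, comul_antipode8]
    conv_lhs => rw [← (ℛ k g).eq]
    simp only [TensorProduct.sum_tmul, map_sum, LinearEquiv.coe_coe,
      TensorProduct.tensorTensorTensorComm_tmul, TensorProduct.map_tmul, theta_tmul8]
    have key := congrArg (psi8 (N := N) Sinv actM m) (yd_key8 actN coactN hydN g n)
    simp only [map_sum] at key
    refine Eq.trans ?_ (key.trans ?_)
    · refine Finset.sum_congr rfl fun i _ => ?_
      induction coactN (actN ((ℛ k g).right i ⊗ₜ[k] n)) with
      | zero => simp
      | add x y hx hy => simp only [map_add, hx, hy]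
      | tmul x y => simp [psi8, smul', s2, hactM2]
    · refine Finset.sum_congr rfl fun i _ => ?_
      induction coactN n with
      | zero => simp
      | add x y hx hy => simp only [map_add, TensorProduct.tmul_add, hx, hy]
      | tmul x y => simp [psi8, smul', s2, hactM2]
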